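/- arXiv:1503.02527 — 2 statements merged into one kernel-verified Lean document; each statement's English description precedes it below -/
import Mathlib

section
/- Let x_0, …, x_n (n ≥ 1) be control points in a real normed vector space V. The Bézier curve B : ℝ → V defined by de Casteljau's algorithm is differentiable at every t ∈ ℝ, with derivative B′(t) = n · Σ_{i=0}^{n−1} (n−1 choose i) · t^i · (1−t)^{n−1−i} · (x_{i+1} − x_i). -/
/-- De Casteljau's algorithm: `casteljau x j i t` is the intermediate point `c_i^j(t)`
for control points `x 0, x 1, …`. -/
noncomputable def casteljau {V : Type*} [AddCommGroup V] [Module ℝ V]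
    (x : ℕ → V) : ℕ → ℕ → ℝ → V
  | 0, i, _ => x i
  | j + 1, i, t => (1 - t) • casteljau x j i t + t • casteljau x j (i + 1) t

/-- The Bézier curve of degree `n` with control points `x 0, …, x n` is `B(t) = c_0^n(t)`. -/
noncomputable def bezier {V : Type*} [AddCommGroup V] [Module ℝ V]
    (x : ℕ → V) (n : ℕ) (t : ℝ) : V :=
  casteljau x n 0 t

/-- The forward difference of de Casteljau points is the de Casteljau point of the
forward differences of the control points. -/
theorem casteljau_succ_sub {V : Type*} [AddCommGroup V] [Module ℝ V]
    (x : ℕ → V) (j i : ℕ) (t : ℝ) :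
    casteljau x j (i + 1) t - casteljau x j i t =
      casteljau (fun k => x (k + 1) - x k) j i t := by
  induction j generalizing i with
  | zero => rfl
  | succ j ih =>
    simp only [casteljau, ← ih]
    module

theorem hasDerivAt_casteljau_succ {V : Type*} [NormedAddCommGroup V] [NormedSpace ℝ V]
    (x : ℕ → V) (j i : ℕ) (t : ℝ) :
    HasDerivAt (casteljau x (j + 1) i)
      (((j : ℝ) + 1) • casteljau (fun k => x (k + 1) - x k) j i t) t := by
  have step {j i : ℕ} {a b : V} (ha : HasDerivAt (casteljau x j i) a t)
      (hb : HasDerivAt (casteljau x j (i + 1)) b t) :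
      HasDerivAt (casteljau x (j + 1) i)
        (casteljau (fun k => x (k + 1) - x k) j i t + ((1 - t) • a + t • b)) t := by
    refine ((((hasDerivAt_id t).const_sub 1).smul ha).add
      ((hasDerivAt_id t).smul hb)).congr_deriv ?_
    simp only [id_eq, ← casteljau_succ_sub]
    module
  induction j generalizing i with
  | zero =>
    have const (i : ℕ) : HasDerivAt (casteljau x 0 i) 0 t := hasDerivAt_const t (x i)
    refine (step (const i) (const (i + 1))).congr_deriv ?_
    simp
  | succ j ih =>
    refine (step (ih i) (ih (i + 1))).congr_deriv ?_
    simp only [casteljau]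
    push_cast
    module

/-- The Bernstein form of the de Casteljau points. -/
theorem casteljau_eq_sum {V : Type*} [AddCommGroup V] [Module ℝ V]
    (x : ℕ → V) (n i : ℕ) (t : ℝ) :
    casteljau x n i t = ∑ k ∈ Finset.range (n + 1),
      ((n.choose k : ℝ) * t ^ k * (1 - t) ^ (n - k)) • x (i + k) := by
  rw [← Finset.Nat.sum_antidiagonal_eq_sum_range_succ
    (fun k l => ((n.choose k : ℝ) * t ^ k * (1 - t) ^ l) • x (i + k))]
  induction n generalizing i with
  | zero => simp [casteljau]
  | succ n ih =>
    have pascal := Finset.sum_antidiagonal_choose_succ_nsmul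
      (fun k l => (t ^ k * (1 - t) ^ l) • x (i + k)) n
    simp only [← Nat.cast_smul_eq_nsmul ℝ, smul_smul, ← mul_assoc] at pascal
    rw [pascal, casteljau, ih, ih, Finset.smul_sum, Finset.smul_sum]
    congr 1 <;> refine Finset.sum_congr rfl fun p hp => ?_
    · rw [smul_smul]
      congr 1
      ring
    · rw [smul_smul, Nat.choose_symm_of_eq_add (Finset.HasAntidiagonal.mem_antidiagonal.mp hp).symm,
        add_right_comm, add_assoc]
      congr 1
      ring

/-- For `n ≥ 1`, the Bézier curve is differentiable at every `t ∈ ℝ` with derivative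
`B′(t) = n · Σ_{i=0}^{n−1} C(n−1, i) t^i (1−t)^{n−1−i} (x_{i+1} − x_i)`. -/
theorem bezier_hasDerivAt {V : Type*} [NormedAddCommGroup V] [NormedSpace ℝ V]
    (n : ℕ) (hn : 1 ≤ n) (x : ℕ → V) (t : ℝ) :
    HasDerivAt (fun s => bezier x n s)
      ((n : ℝ) • ∑ i ∈ Finset.range n,
        (((n - 1).choose i : ℝ) * t ^ i * (1 - t) ^ (n - 1 - i)) • (x (i + 1) - x i)) t := by
  obtain ⟨m, rfl⟩ := Nat.exists_eq_add_of_le' hn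
  refine (hasDerivAt_casteljau_succ x m 0 t).congr_deriv ?_
  rw [casteljau_eq_sum]
  simp
end

section
/- Let x_0, …, x_n (n ≥ 1) be control points in a real normed vector space V and B : ℝ → V the Bézier curve defined by de Casteljau's algorithm. Then the endpoint velocities are given in terms of the control points by B′(0) = n·(x_1 − x_0) and B′(1) = n·(x_n − x_{n−1}). -/
@[simp]
theorem casteljau_apply_zero {V : Type*} [AddCommGroup V] [Module ℝ V]
    (x : ℕ → V) (j i : ℕ) : casteljau x j i 0 = x i := by
  induction j generalizing i with
  | zero => rfl
  | succ j ih => simp [casteljau, ih]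

@[simp]
theorem casteljau_apply_one {V : Type*} [AddCommGroup V] [Module ℝ V]
    (x : ℕ → V) (j i : ℕ) : casteljau x j i 1 = x (i + j) := by
  induction j generalizing i with
  | zero => rfl
  | succ j ih => simp [casteljau, ih, add_assoc, add_comm 1 j]

theorem HasDerivAt.casteljau_succ {V : Type*} [NormedAddCommGroup V] [NormedSpace ℝ V]
    {x : ℕ → V} {j i : ℕ} {t : ℝ} {v w : V}
    (hv : HasDerivAt (casteljau x j i) v t) (hw : HasDerivAt (casteljau x j (i + 1)) w t) :
    HasDerivAt (casteljau x (j + 1) i)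
      ((1 - t) • v + t • w + (casteljau x j (i + 1) t - casteljau x j i t)) t := by
  have h := (((hasDerivAt_id t).const_sub 1).smul hv).add ((hasDerivAt_id t).smul hw)
  refine h.congr_deriv ?_
  simp only [id]
  module

theorem hasDerivAt_casteljau_zero {V : Type*} [NormedAddCommGroup V] [NormedSpace ℝ V]
    (x : ℕ → V) (j i : ℕ) :
    HasDerivAt (casteljau x j i) ((j : ℝ) • (x (i + 1) - x i)) 0 := by
  induction j generalizing i with
  | zero => exact (hasDerivAt_const (0 : ℝ) (x i)).congr_deriv (by simp)
  | succ j ih =>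
    refine ((ih i).casteljau_succ (ih (i + 1))).congr_deriv ?_
    simp only [casteljau_apply_zero, Nat.cast_succ]
    module

theorem hasDerivAt_casteljau_one {V : Type*} [NormedAddCommGroup V] [NormedSpace ℝ V]
    (x : ℕ → V) (j i : ℕ) :
    HasDerivAt (casteljau x j i) ((j : ℝ) • (x (i + j) - x (i + j - 1))) 1 := by
  induction j generalizing i with
  | zero => exact (hasDerivAt_const (1 : ℝ) (x i)).congr_deriv (by simp)
  | succ j ih =>
    refine ((ih i).casteljau_succ (ih (i + 1))).congr_deriv ?_
    simp only [casteljau_apply_one, Nat.cast_succ, show i + 1 + j = i + (j + 1) by lia,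
      show i + (j + 1) - 1 = i + j by lia]
    module

/-- For `n ≥ 1`, the endpoint velocities of the Bézier curve are given in terms of the
control points by `B′(0) = n (x₁ − x₀)` and `B′(1) = n (xₙ − x_{n−1})`. -/
theorem bezier_endpoint_velocities {V : Type*} [NormedAddCommGroup V] [NormedSpace ℝ V]
    (n : ℕ) (hn : 1 ≤ n) (x : ℕ → V) :
    HasDerivAt (fun s => bezier x n s) ((n : ℝ) • (x 1 - x 0)) 0 ∧
    HasDerivAt (fun s => bezier x n s) ((n : ℝ) • (x n - x (n - 1))) 1 := by
  refine ⟨?_, ?_⟩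
  · simpa [bezier] using hasDerivAt_casteljau_zero x n 0
  · simpa [bezier] using hasDerivAt_casteljau_one x n 0
end
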